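/- Let g be in normal form, fix n ≥ 1, and assume a_{i,1} = 0 for 2 ≤ i ≤ n (no condition when n = 1) and a_{n+1,1} ≠ 0. Let θ₀ ∈ (−π/2, π/2), A(θ₀) = √(a_{n+1,1}² cos²θ₀ + ((n+1)!)² sin²θ₀), and ν₀ = σ·(0, −a_{n+1,1} cosθ₀ / A(θ₀), (n+1)! sinθ₀ / A(θ₀)) for a sign σ ∈ {1,−1}. Then the height function h_{ν₀} has an A₂ singularity at (0,0) if and only if a_{n+1,1} b₂ cosθ₀ − (n+1)! a_{2,0} sinθ₀ = 0 (parabolic point over the singularity) and a_{n+1,1} b₃ cosθ₀ − (n+1)! a_{3,0} sinθ₀ ≠ 0 (not a ridge point over the singularity). -/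

import Mathlib

open Real Set

noncomputable section

/-- Partial derivative in the first variable. -/
def pdu {F : Type*} [NormedAddCommGroup F] [NormedSpace ℝ F] (f : ℝ → ℝ → F) : ℝ → ℝ → F :=
  fun u w => deriv (fun t => f t w) u

/-- Partial derivative in the second variable. -/
def pdw {F : Type*} [NormedAddCommGroup F] [NormedSpace ℝ F] (f : ℝ → ℝ → F) : ℝ → ℝ → F :=
  fun u w => deriv (fun t => f u t) w

/-- Iterated partial derivative `∂_u^i ∂_w^j f`. -/
def pd {F : Type*} [NormedAddCommGroup F] [NormedSpace ℝ F] (i j : ℕ) (f : ℝ → ℝ → F) :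
    ℝ → ℝ → F :=
  pdu^[i] (pdw^[j] f)

/-- The Euclidean inner product on `ℝ³ = ℝ × ℝ × ℝ`. -/
def dot3 (x y : ℝ × ℝ × ℝ) : ℝ := x.1 * y.1 + x.2.1 * y.2.1 + x.2.2 * y.2.2

/-- The cross product on `ℝ³ = ℝ × ℝ × ℝ`. -/
def cross3 (x y : ℝ × ℝ × ℝ) : ℝ × ℝ × ℝ :=
  (x.2.1 * y.2.2 - x.2.2 * y.2.1, x.2.2 * y.1 - x.1 * y.2.2, x.1 * y.2.1 - x.2.1 * y.1)

/-- The Euclidean norm on `ℝ³ = ℝ × ℝ × ℝ`. -/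
def norm3 (x : ℝ × ℝ × ℝ) : ℝ := Real.sqrt (dot3 x x)

/-- The surface parameterization `g(u,w) = (u, p(u,w), q(u,w))`. -/
def gmap (p q : ℝ → ℝ → ℝ) : ℝ → ℝ → ℝ × ℝ × ℝ := fun u w => (u, p u w, q u w)

/-- The height function on the surface parameterized by `g = (u, p, q)` along `v`. -/
def hgt (p q : ℝ → ℝ → ℝ) (v : ℝ × ℝ × ℝ) : ℝ → ℝ → ℝ :=
  fun u w => dot3 (gmap p q u w) v

/-- `g = (u, p(u,w), q(u,w))` is in normal form of order `N`. -/
def NormalFormN (N : ℕ) (p q : ℝ → ℝ → ℝ) (b : ℕ → ℝ) (a : ℕ → ℕ → ℝ) : Prop :=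
  ContDiff ℝ (⊤ : ℕ∞) (fun x : ℝ × ℝ => p x.1 x.2) ∧
  ContDiff ℝ (⊤ : ℕ∞) (fun x : ℝ × ℝ => q x.1 x.2) ∧
  p 0 0 = 0 ∧ q 0 0 = 0 ∧
  pd 1 0 p 0 0 = 0 ∧ pd 0 1 p 0 0 = 0 ∧ pd 1 0 q 0 0 = 0 ∧ pd 0 1 q 0 0 = 0 ∧
  pd 0 2 p 0 0 = 1 ∧
  (∀ i, 2 ≤ i → i ≤ N → pd i 0 p 0 0 = b i) ∧
  (∀ i j, 2 ≤ i + j → i + j ≤ N → 1 ≤ j → ¬(i = 0 ∧ j = 2) → pd i j p 0 0 = 0) ∧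
  (∀ i j, 2 ≤ i + j → i + j ≤ N → pd i j q 0 0 = a i j) ∧
  a 1 1 = 0 ∧ a 0 2 = 0

/-- `h` has an `A_k` singularity at the origin: up to a `C^∞` change of coordinates fixing
the origin, `h` equals `h(0,0) ± x² ± y^(k+1)`. -/
def HasAkSingAt (h : ℝ → ℝ → ℝ) (k : ℕ) : Prop :=
  ∃ (U V : Set (ℝ × ℝ)) (φ ψ : ℝ × ℝ → ℝ × ℝ) (ε₁ ε₂ : ℝ),
    IsOpen U ∧ IsOpen V ∧ ((0, 0) : ℝ × ℝ) ∈ U ∧ ((0, 0) : ℝ × ℝ) ∈ V ∧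
    ContDiffOn ℝ (⊤ : ℕ∞) φ U ∧ ContDiffOn ℝ (⊤ : ℕ∞) ψ V ∧
    Set.MapsTo φ U V ∧ Set.MapsTo ψ V U ∧
    (∀ x ∈ U, ψ (φ x) = x) ∧ (∀ y ∈ V, φ (ψ y) = y) ∧
    φ (0, 0) = (0, 0) ∧ (ε₁ = 1 ∨ ε₁ = -1) ∧ (ε₂ = 1 ∨ ε₂ = -1) ∧
    ∀ x ∈ U, h (φ x).1 (φ x).2 = h 0 0 + ε₁ * x.1 ^ 2 + ε₂ * x.2 ^ (k + 1)

/-- The parabolic-set function `Σ = ⟨g_uu, g_u × g_w⟩⟨g_ww, g_u × g_w⟩ − ⟨g_uw, g_u × g_w⟩²`. -/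
def SigmaFun (p q : ℝ → ℝ → ℝ) : ℝ → ℝ → ℝ := fun u w =>
  dot3 (pd 2 0 (gmap p q) u w) (cross3 (pd 1 0 (gmap p q) u w) (pd 0 1 (gmap p q) u w)) *
      dot3 (pd 0 2 (gmap p q) u w) (cross3 (pd 1 0 (gmap p q) u w) (pd 0 1 (gmap p q) u w)) -
    dot3 (pd 1 1 (gmap p q) u w) (cross3 (pd 1 0 (gmap p q) u w) (pd 0 1 (gmap p q) u w)) ^ 2

/-- The torsion of a space curve `L`. -/
def tor (L : ℝ → ℝ × ℝ × ℝ) : ℝ → ℝ := fun t =>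
  dot3 (cross3 (deriv L t) (deriv (deriv L) t)) (deriv (deriv (deriv L)) t) /
    norm3 (cross3 (deriv L t) (deriv (deriv L) t)) ^ 2

/-- The unit binormal vector of a space curve `L` at `t = 0`. -/
def binormal0 (L : ℝ → ℝ × ℝ × ℝ) : ℝ × ℝ × ℝ :=
  (norm3 (cross3 (deriv L 0) (deriv (deriv L) 0)))⁻¹ • cross3 (deriv L 0) (deriv (deriv L) 0)

/-- `f` is a parabolic Monge form with `∂_w² f(0,0) = k₂ ≠ 0`. -/
def MongeForm (f : ℝ → ℝ → ℝ) (k₂ : ℝ) : Prop :=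
  ContDiff ℝ (⊤ : ℕ∞) (fun x : ℝ × ℝ => f x.1 x.2) ∧ f 0 0 = 0 ∧
  pd 1 0 f 0 0 = 0 ∧ pd 0 1 f 0 0 = 0 ∧
  pd 2 0 f 0 0 = 0 ∧ pd 1 1 f 0 0 = 0 ∧ pd 0 2 f 0 0 = k₂ ∧ k₂ ≠ 0

/-- The parabolic-set function `P = f_uu f_ww − f_uw²` of a Monge form. -/
def Pfun (f : ℝ → ℝ → ℝ) : ℝ → ℝ → ℝ := fun u w =>
  pd 2 0 f u w * pd 0 2 f u w - pd 1 1 f u w ^ 2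

/-- A parametric integral over a compact interval of a smooth function is `C^n`. -/
theorem contDiff_nat_parametric_intervalIntegral {E : Type} [NormedAddCommGroup E]
    [NormedSpace ℝ E] [FiniteDimensional ℝ E] (a b : ℝ) (n : ℕ) :
    ∀ {F : Type} [NormedAddCommGroup F] [NormedSpace ℝ F] {f : E × ℝ → F},
      ContDiff ℝ (⊤ : ℕ∞) f → ContDiff ℝ n (fun x => ∫ t in a..b, f (x, t)) := by
  induction n with
  | zero =>
    intro F _ _ f hf
    have hc : Continuous f := hf.continuous
    exact contDiff_zero.2
      (intervalIntegral.continuous_parametric_intervalIntegral_of_continuous'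
        (f := fun x t => f (x, t)) hc a b)
  | succ n ih =>
    intro F _ _ f hf
    have hg : ContDiff ℝ (⊤ : ℕ∞)
        (fun z : E × ℝ => (fderiv ℝ f z).comp (ContinuousLinearMap.inl ℝ E ℝ)) :=
      (hf.fderiv_right le_rfl).clm_comp contDiff_const
    have hgc := hg.continuous
    have hfc : Continuous f := hf.continuous
    refine contDiff_succ_iff_hasFDerivAt.2 ⟨_, ih hg, fun x₀ => ?_⟩
    obtain ⟨M, hM⟩ := ((isCompact_closedBall x₀ 1).prod (isCompact_uIcc (a := a) (b := b))
      ).exists_bound_of_continuousOn hgc.continuousOn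
    refine intervalIntegral.hasFDerivAt_integral_of_dominated_of_fderiv_le
      (F := fun x t => f (x, t))
      (F' := fun x t => (fderiv ℝ f (x, t)).comp (ContinuousLinearMap.inl ℝ E ℝ))
      (bound := fun _ => M) (Metric.closedBall_mem_nhds x₀ one_pos) ?_ ?_ ?_ ?_ ?_ ?_
    · exact Filter.Eventually.of_forall fun x =>
        (hfc.comp (Continuous.prodMk_right x)).aestronglyMeasurable
    · exact (hfc.comp (Continuous.prodMk_right x₀)).intervalIntegrable _ _
    · exact (hgc.comp (Continuous.prodMk_right x₀)).aestronglyMeasurable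
    · exact Filter.Eventually.of_forall fun t ht x hx =>
        hM (x, t) ⟨hx, Set.uIoc_subset_uIcc ht⟩
    · exact intervalIntegrable_const
    · refine Filter.Eventually.of_forall fun t _ x _ => ?_
      exact ((hf.differentiable (by simp)) (x, t)).hasFDerivAt.comp x
        (hasFDerivAt_prodMk_left x t)

/-- **Hadamard lemma** with one parameter. -/
theorem exists_contDiff_eq_add_mul {f : ℝ × ℝ → ℝ} (hf : ContDiff ℝ (⊤ : ℕ∞) f) :
    ∃ K : ℝ × ℝ → ℝ, ContDiff ℝ (⊤ : ℕ∞) K ∧ ∀ u w, f (u, w) = f (u, 0) + w * K (u, w) := by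
  have hg : ContDiff ℝ (⊤ : ℕ∞)
      (fun z : (ℝ × ℝ) × ℝ => fderiv ℝ f (z.1.1, z.2 * z.1.2) (0, 1)) := by
    refine ContDiff.clm_apply ((hf.fderiv_right (m := (⊤ : ℕ∞)) le_rfl).comp ?_) contDiff_const
    fun_prop
  refine ⟨fun x => ∫ t in (0 : ℝ)..1, fderiv ℝ f (x.1, t * x.2) (0, 1), ?_, fun u w => ?_⟩
  · exact contDiff_iff_forall_nat_le.2 fun m _ =>
      contDiff_nat_parametric_intervalIntegral 0 1 m hg
  · have hderiv : ∀ t : ℝ, HasDerivAt (fun t : ℝ => f (u, t * w))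
        (w * fderiv ℝ f (u, t * w) (0, 1)) t := by
      intro t
      have h1 : HasDerivAt (fun t : ℝ => (u, t * w)) ((0 : ℝ), w) t := by
        simpa using (hasDerivAt_const t u).prodMk ((hasDerivAt_id t).mul_const w)
      have h2 := ((hf.differentiable (by simp)) (u, t * w)).hasFDerivAt.comp_hasDerivAt t h1
      have h3 : ((0 : ℝ), w) = w • ((0 : ℝ), (1 : ℝ)) := by simp
      rw [h3, map_smul] at h2
      exact h2
    have hcont : Continuous (fun t : ℝ => w * fderiv ℝ f (u, t * w) (0, 1)) :=
      continuous_const.mul (hg.continuous.comp (Continuous.prodMk_right (u, w)))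
    have := intervalIntegral.integral_eq_sub_of_hasDerivAt (fun t _ => hderiv t)
      (hcont.intervalIntegrable 0 1)
    rw [intervalIntegral.integral_const_mul] at this
    simp only [one_mul, zero_mul] at this
    simp only [this]
    ring

/-- **Hadamard lemma** on the real line. -/
theorem exists_contDiff_eq_add_mul_real {f : ℝ → ℝ} (hf : ContDiff ℝ (⊤ : ℕ∞) f) :
    ∃ k : ℝ → ℝ, ContDiff ℝ (⊤ : ℕ∞) k ∧ ∀ t, f t = f 0 + t * k t := by
  obtain ⟨K, hK, h⟩ := exists_contDiff_eq_add_mul (hf.comp (contDiff_snd (E := ℝ)))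
  exact ⟨fun t => K (0, t), hK.comp (contDiff_prodMk_right 0), fun t => h 0 t⟩

/-- The derivative of `t ↦ c + t * g t`. -/
theorem deriv_const_add_id_mul {f g : ℝ → ℝ} (c : ℝ) (hg : Differentiable ℝ g)
    (h : ∀ t, f t = c + t * g t) : deriv f = fun t => g t + t * deriv g t := by
  funext t
  rw [funext h]
  have := ((hasDerivAt_id t).mul (hg t).hasDerivAt).const_add c
  simpa using this.deriv

/-- The second derivative at `0` of `t ↦ c + t * g t`. -/
theorem deriv_deriv_const_add_id_mul_zero {f g : ℝ → ℝ} (c : ℝ) (hg : ContDiff ℝ (⊤ : ℕ∞) g)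
    (h : ∀ t, f t = c + t * g t) : deriv (deriv f) 0 = 2 * deriv g 0 := by
  rw [deriv_const_add_id_mul c (hg.differentiable (by simp)) h]
  have hg' : Differentiable ℝ (deriv g) :=
    (contDiff_infty_iff_deriv.1 hg).2.differentiable (by simp)
  have := ((hg.differentiable (by simp)) 0).hasDerivAt.add
    ((hasDerivAt_id (0 : ℝ)).mul (hg' 0).hasDerivAt)
  refine this.deriv.trans ?_
  simp
  ring

/-- The third derivative at `0` of `t ↦ c + t * g t`. -/
theorem deriv_deriv_deriv_const_add_id_mul_zero {f g : ℝ → ℝ} (c : ℝ)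
    (hg : ContDiff ℝ (⊤ : ℕ∞) g) (h : ∀ t, f t = c + t * g t) :
    deriv (deriv (deriv f)) 0 = 3 * deriv (deriv g) 0 := by
  have hg1 := (contDiff_infty_iff_deriv.1 hg).2
  have hg2 := (contDiff_infty_iff_deriv.1 hg1).2
  rw [deriv_const_add_id_mul c (hg.differentiable (by simp)) h]
  have h2 : deriv (fun t => g t + t * deriv g t) =
      fun t => 2 * deriv g t + t * deriv (deriv g) t := by
    funext t
    have := ((hg.differentiable (by simp)) t).hasDerivAt.add
      ((hasDerivAt_id t).mul ((hg1.differentiable (by simp)) t).hasDerivAt)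
    refine this.deriv.trans ?_
    simp
    ring
  rw [h2]
  have := (((hg1.differentiable (by simp)) 0).hasDerivAt.const_mul 2).add
    ((hasDerivAt_id (0 : ℝ)).mul ((hg2.differentiable (by simp)) 0).hasDerivAt)
  refine this.deriv.trans ?_
  simp
  ring

/-- Third-order expansion of a smooth function of two variables, with smooth remainders. -/
theorem exists_expansion {H : ℝ → ℝ → ℝ}
    (hH : ContDiff ℝ (⊤ : ℕ∞) (fun x : ℝ × ℝ => H x.1 x.2)) :
    ∃ (A B : ℝ → ℝ) (R : ℝ × ℝ → ℝ), ContDiff ℝ (⊤ : ℕ∞) A ∧ ContDiff ℝ (⊤ : ℕ∞) B ∧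
      ContDiff ℝ (⊤ : ℕ∞) R ∧ pd 3 0 H 0 0 = 6 * A 0 ∧ pd 0 2 H 0 0 = 2 * R (0, 0) ∧
      ∀ u w, H u w = H 0 0 + u * (pd 1 0 H 0 0 + u * (pd 2 0 H 0 0 / 2 + u * A u)) +
        w * (pd 0 1 H 0 0 + u * (pd 1 1 H 0 0 + u * B u) + w * R (u, w)) := by
  obtain ⟨K, hK, hHK⟩ := exists_contDiff_eq_add_mul hH
  obtain ⟨R, hR, hKR⟩ := exists_contDiff_eq_add_mul hK
  simp only at hHK
  have hα : ContDiff ℝ (⊤ : ℕ∞) (fun u => H u 0) := hH.comp (contDiff_prodMk_left 0)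
  have hβ : ContDiff ℝ (⊤ : ℕ∞) (fun u => K (u, 0)) := hK.comp (contDiff_prodMk_left 0)
  have hK0 : ContDiff ℝ (⊤ : ℕ∞) (fun w => K (0, w)) := hK.comp (contDiff_prodMk_right 0)
  have hR0 : ContDiff ℝ (⊤ : ℕ∞) (fun w => R (0, w)) := hR.comp (contDiff_prodMk_right 0)
  obtain ⟨α₁, hα₁, hαα₁⟩ := exists_contDiff_eq_add_mul_real hα
  obtain ⟨α₂, hα₂, hαα₂⟩ := exists_contDiff_eq_add_mul_real hα₁
  obtain ⟨α₃, hα₃, hαα₃⟩ := exists_contDiff_eq_add_mul_real hα₂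
  obtain ⟨β₁, hβ₁, hββ₁⟩ := exists_contDiff_eq_add_mul_real hβ
  obtain ⟨β₂, hβ₂, hββ₂⟩ := exists_contDiff_eq_add_mul_real hβ₁
  have hw : ∀ u, pdw H u 0 = K (u, 0) := by
    intro u
    have hKu : ContDiff ℝ (⊤ : ℕ∞) (fun w => K (u, w)) := hK.comp (contDiff_prodMk_right u)
    have := congrFun (deriv_const_add_id_mul (f := fun w => H u w) _
      (hKu.differentiable (by simp)) (fun w => hHK u w)) 0
    simpa [pdw] using this
  have d1 : ∀ {f g : ℝ → ℝ}, ContDiff ℝ (⊤ : ℕ∞) g → (∀ t, f t = f 0 + t * g t) →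
      deriv f 0 = g 0 := fun {f g} hg h => by
    simpa using congrFun (deriv_const_add_id_mul (f 0) (hg.differentiable (by simp)) h) 0
  have e10 : pd 1 0 H 0 0 = α₁ 0 := d1 hα₁ hαα₁
  have e01 : pd 0 1 H 0 0 = K (0, 0) := hw 0
  have e11 : pd 1 1 H 0 0 = β₁ 0 := by
    change deriv (fun t => pdw H t 0) 0 = _
    simp only [hw]
    exact d1 hβ₁ hββ₁
  have e20 : pd 2 0 H 0 0 = 2 * α₂ 0 :=
    (deriv_deriv_const_add_id_mul_zero _ hα₁ hαα₁).trans (by rw [d1 hα₂ hαα₂])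
  have e30 : pd 3 0 H 0 0 = 6 * α₃ 0 := by
    refine (deriv_deriv_deriv_const_add_id_mul_zero _ hα₁ hαα₁).trans ?_
    rw [deriv_deriv_const_add_id_mul_zero _ hα₂ hαα₂, d1 hα₃ hαα₃]
    ring
  have e02 : pd 0 2 H 0 0 = 2 * R (0, 0) := by
    refine (deriv_deriv_const_add_id_mul_zero (f := fun w => H 0 w) _ hK0
      (fun w => hHK 0 w)).trans ?_
    rw [d1 hR0 (fun w => hKR 0 w)]
  refine ⟨α₃, β₂, R, hα₃, hβ₂, hR, e30, e02, fun u w => ?_⟩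
  rw [e10, e01, e11, e20, hHK, hKR, hαα₁, hαα₂, hαα₃, hββ₁, hββ₂]
  ring

/-- The inverse function theorem for maps that are smooth on an open neighbourhood. -/
theorem exists_local_smooth_inverse {E : Type*} [NormedAddCommGroup E] [NormedSpace ℝ E]
    [CompleteSpace E] {Ψ : E → E} {W : Set E} (hW : IsOpen W) {x₀ : E} (hx₀ : x₀ ∈ W)
    (hΨ : ContDiffOn ℝ (⊤ : ℕ∞) Ψ W) {L : E ≃L[ℝ] E}
    (hL : HasFDerivAt Ψ (L : E →L[ℝ] E) x₀) :
    ∃ e : OpenPartialHomeomorph E E, (e : E → E) = Ψ ∧ x₀ ∈ e.source ∧ e.source ⊆ W ∧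
      ContDiffOn ℝ (⊤ : ℕ∞) e.symm e.target := by
  have hat : ContDiffAt ℝ (⊤ : ℕ∞) Ψ x₀ := hΨ.contDiffAt (hW.mem_nhds hx₀)
  have hopen : IsOpen (W ∩ fderiv ℝ Ψ ⁻¹' range ((↑) : (E ≃L[ℝ] E) → E →L[ℝ] E)) :=
    (hΨ.continuousOn_fderiv_of_isOpen hW (by simp)).isOpen_inter_preimage hW
      (ContinuousLinearEquiv.isOpen (𝕜 := ℝ) (E := E) (F := E))
  refine ⟨(hat.toOpenPartialHomeomorph Ψ hL (by simp)).restrOpen _ hopen, rfl, ?_, ?_, ?_⟩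
  · exact ⟨hat.mem_toOpenPartialHomeomorph_source hL (by simp), hx₀, L, hL.fderiv.symm⟩
  · exact fun x hx => hx.2.1
  · intro y hy
    set e := (hat.toOpenPartialHomeomorph Ψ hL (by simp)).restrOpen _ hopen
    obtain ⟨-, hyW, L', hL'⟩ := e.map_target hy
    refine (e.contDiffAt_symm (f₀' := L') hy ?_ ?_).contDiffWithinAt
    · rw [hL']
      exact ((hΨ.contDiffAt (hW.mem_nhds hyW)).differentiableAt (by simp)).hasFDerivAt
    · exact hΨ.contDiffAt (hW.mem_nhds hyW)

/-- Sign of a nonzero real number. -/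
theorem exists_sign_mul_pos {r : ℝ} (hr : r ≠ 0) : ∃ ε : ℝ, (ε = 1 ∨ ε = -1) ∧ 0 < ε * r := by
  rcases hr.lt_or_gt with h | h
  · exact ⟨-1, Or.inr rfl, by linarith⟩
  · exact ⟨1, Or.inl rfl, by linarith⟩

/-- The linear automorphism `(u, w) ↦ (m * w, c * u)` of the plane. -/
def swapScale (m c : ℝ) (hm : m ≠ 0) (hc : c ≠ 0) : (ℝ × ℝ) ≃L[ℝ] (ℝ × ℝ) :=
  ContinuousLinearEquiv.equivOfInverse
    ((m • ContinuousLinearMap.snd ℝ ℝ ℝ).prod (c • ContinuousLinearMap.fst ℝ ℝ ℝ))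
    ((c⁻¹ • ContinuousLinearMap.snd ℝ ℝ ℝ).prod (m⁻¹ • ContinuousLinearMap.fst ℝ ℝ ℝ))
    (fun x => by ext <;> simp [hm, hc]) (fun x => by ext <;> simp [hm, hc])

/-- A product with a factor vanishing at the point has the derivative of that factor, scaled. -/
theorem HasFDerivAt.mul_of_eq_zero {E : Type*} [NormedAddCommGroup E] [NormedSpace ℝ E]
    {f g : E → ℝ} {x : E} {g' : E →L[ℝ] ℝ} (hf : DifferentiableAt ℝ f x)
    (hg : HasFDerivAt g g' x) (h0 : g x = 0) :
    HasFDerivAt (fun y => f y * g y) (f x • g') x := by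
  have h := hf.hasFDerivAt.mul hg
  rw [h0, zero_smul, add_zero] at h
  exact h

/-- A smooth function with a degenerate Hessian along the first axis and nonvanishing third
derivative in that direction has an `A₂` singularity. -/
theorem hasAkSingAt_two_of_pd {H : ℝ → ℝ → ℝ}
    (hH : ContDiff ℝ (⊤ : ℕ∞) (fun x : ℝ × ℝ => H x.1 x.2))
    (h10 : pd 1 0 H 0 0 = 0) (h01 : pd 0 1 H 0 0 = 0) (h11 : pd 1 1 H 0 0 = 0)
    (h02 : pd 0 2 H 0 0 ≠ 0) (h20 : pd 2 0 H 0 0 = 0) (h30 : pd 3 0 H 0 0 ≠ 0) :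
    HasAkSingAt H 2 := by
  obtain ⟨A, B, R, hA, hB, hR, e30, e02, hexp⟩ := exists_expansion hH
  simp only [h10, h01, h11, h20, zero_div, zero_add] at hexp
  have hR0 : R (0, 0) ≠ 0 := fun h => h02 (by rw [e02, h, mul_zero])
  have hA0 : A 0 ≠ 0 := fun h => h30 (by rw [e30, h, mul_zero])
  obtain ⟨ε₁, hε₁, hp₁⟩ := exists_sign_mul_pos hR0
  obtain ⟨ε₂, hε₂, hp₂⟩ := exists_sign_mul_pos hA0
  have hs₁ : ε₁ * ε₁ = 1 := by rcases hε₁ with h | h <;> rw [h] <;> norm_num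
  have hs₂ : ε₂ * ε₂ = 1 := by rcases hε₂ with h | h <;> rw [h] <;> norm_num
  set S : ℝ × ℝ → ℝ := fun x => 4 * A x.1 * R x - x.1 * B x.1 ^ 2 with hSdef
  have hA' : ContDiff ℝ (⊤ : ℕ∞) (fun x : ℝ × ℝ => A x.1) := hA.comp contDiff_fst
  have hB' : ContDiff ℝ (⊤ : ℕ∞) (fun x : ℝ × ℝ => B x.1) := hB.comp contDiff_fst
  have hS : ContDiff ℝ (⊤ : ℕ∞) S :=
    ((contDiff_const.mul hA').mul hR).sub (contDiff_fst.mul (hB'.pow 2))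
  set W : Set (ℝ × ℝ) := {x | 0 < ε₁ * R x} ∩ {x | 0 < ε₁ * ε₂ * S x} with hWdef
  have hW : IsOpen W :=
    (isOpen_lt continuous_const (continuous_const.mul hR.continuous)).inter
      (isOpen_lt continuous_const (continuous_const.mul hS.continuous))
  have hRW : ∀ x ∈ W, R x ≠ 0 := fun x hx h => by
    have := hx.1
    simp [h] at this
  have hTpos : ∀ x ∈ W, 0 < ε₂ * S x / (4 * R x) := fun x hx => by
    have h1 : 0 < ε₁ * R x := hx.1
    have h2 : 0 < ε₁ * ε₂ * S x := hx.2
    have h3 : ε₂ * S x / (4 * R x) = (ε₁ * ε₂ * S x) / (4 * (ε₁ * R x)) := by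
      have := hRW x hx
      have : ε₁ ≠ 0 := by rintro rfl; simp at hs₁
      field_simp
    rw [h3]
    positivity
  have h0W : ((0, 0) : ℝ × ℝ) ∈ W := by
    refine ⟨hp₁, ?_⟩
    simp only [hSdef, Set.mem_ofPred_eq]
    nlinarith [mul_pos hp₁ hp₂]
  set m : ℝ × ℝ → ℝ := fun x => Real.sqrt (ε₁ * R x) with hm
  set c : ℝ × ℝ → ℝ := fun x => (ε₂ * S x / (4 * R x)) ^ ((1 : ℝ) / 3) with hc
  set l : ℝ × ℝ → ℝ := fun x => B x.1 / (2 * R x) with hl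
  have hmW : ContDiffOn ℝ (⊤ : ℕ∞) m W :=
    (contDiff_const.mul hR).contDiffOn.sqrt fun x hx => ne_of_gt hx.1
  have hcW : ContDiffOn ℝ (⊤ : ℕ∞) c W :=
    ((contDiff_const.mul hS).contDiffOn.div (contDiff_const.mul hR).contDiffOn
      fun x hx => mul_ne_zero (by norm_num) (hRW x hx)).rpow_const_of_ne
      fun x hx => (hTpos x hx).ne'
  have hlW : ContDiffOn ℝ (⊤ : ℕ∞) l W :=
    hB'.contDiffOn.div (contDiff_const.mul hR).contDiffOn
      fun x hx => mul_ne_zero (by norm_num) (hRW x hx)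
  set Ψ : ℝ × ℝ → ℝ × ℝ := fun x => (m x * (x.2 + x.1 * l x * x.1), c x * x.1) with hΨdef
  have hΨ : ContDiffOn ℝ (⊤ : ℕ∞) Ψ W :=
    (hmW.mul (contDiffOn_snd.add ((contDiffOn_fst.mul hlW).mul contDiffOn_fst))).prodMk
      (hcW.mul contDiffOn_fst)
  have hdiff : ∀ {f : ℝ × ℝ → ℝ}, ContDiffOn ℝ (⊤ : ℕ∞) f W → DifferentiableAt ℝ f (0, 0) :=
    fun hf => (hf.contDiffAt (hW.mem_nhds h0W)).differentiableAt (by simp)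
  have hm0 : m (0, 0) ≠ 0 := (Real.sqrt_pos.2 hp₁).ne'
  have hc0 : c (0, 0) ≠ 0 := (Real.rpow_pos_of_pos (hTpos _ h0W) _).ne'
  have hL : HasFDerivAt Ψ (swapScale _ _ hm0 hc0 : (ℝ × ℝ) →L[ℝ] (ℝ × ℝ)) (0, 0) := by
    have h1 := HasFDerivAt.mul_of_eq_zero (hdiff (contDiffOn_fst.mul hlW))
      (hasFDerivAt_fst (𝕜 := ℝ) (p := ((0, 0) : ℝ × ℝ))) rfl
    have h2 := (hasFDerivAt_snd (𝕜 := ℝ) (p := ((0, 0) : ℝ × ℝ))).add h1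
    have h3 := HasFDerivAt.mul_of_eq_zero (hdiff hmW) h2 (by simp)
    have h4 := HasFDerivAt.mul_of_eq_zero (hdiff hcW)
      (hasFDerivAt_fst (𝕜 := ℝ) (p := ((0, 0) : ℝ × ℝ))) rfl
    convert! h3.prodMk h4 using 1
    ext <;> simp [swapScale]
  obtain ⟨e, heΨ, h0e, heW, hesymm⟩ := exists_local_smooth_inverse hW h0W hΨ hL
  have he0 : e (0, 0) = (0, 0) := by
    rw [heΨ]
    simp [hΨdef]
  refine ⟨e.target, e.source, e.symm, e, ε₁, ε₂, e.open_target, e.open_source,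
    he0 ▸ e.map_source h0e, h0e, hesymm, heΨ ▸ hΨ.mono heW, fun x hx => e.map_target hx,
    fun x hx => e.map_source hx, fun x hx => e.right_inv hx, fun x hx => e.left_inv hx, ?_,
    hε₁, hε₂, fun x hx => ?_⟩
  · rw [← he0, e.left_inv h0e, he0]
  · obtain ⟨y, hy, rfl⟩ : ∃ y ∈ e.source, e y = x := ⟨_, e.map_target hx, e.right_inv hx⟩
    rw [e.left_inv hy, heΨ]
    have hyW := heW hy
    have hRy := hRW y hyW
    have hm2 : m y ^ 2 = ε₁ * R y := Real.sq_sqrt (le_of_lt hyW.1)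
    have hc3 : c y ^ 3 = ε₂ * S y / (4 * R y) := by
      rw [hc, ← Real.rpow_natCast, ← Real.rpow_mul (hTpos y hyW).le]
      norm_num
    have hgoal : ε₁ * (m y * (y.2 + y.1 * l y * y.1)) ^ 2 + ε₂ * (c y * y.1) ^ (2 + 1) =
        y.1 * (y.1 * (y.1 * A y.1)) + y.2 * (y.1 * (y.1 * B y.1) + y.2 * R y) := by
      calc _ = (ε₁ * m y ^ 2) * (y.2 + y.1 * l y * y.1) ^ 2 + (ε₂ * c y ^ 3) * y.1 ^ 3 := by ring
        _ = (ε₁ * ε₁) * R y * (y.2 + y.1 * l y * y.1) ^ 2 +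
            (ε₂ * ε₂) * (S y / (4 * R y)) * y.1 ^ 3 := by rw [hm2, hc3]; ring
        _ = _ := by
          rw [hs₁, hs₂]
          simp only [hl, hSdef]
          field_simp
          ring
    rw [hexp, add_assoc, add_assoc, hgoal]

section SlicewiseDerivatives

variable {f g : ℝ → ℝ → ℝ} {V : Set (ℝ × ℝ)} {u w : ℝ}

theorem hasDerivAt_pdu (hV : IsOpen V)
    (hf : ContDiffOn ℝ (⊤ : ℕ∞) (fun x : ℝ × ℝ => f x.1 x.2) V) (hx : (u, w) ∈ V) :
    HasDerivAt (fun t => f t w) (pdu f u w) u := by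
  have h0 : DifferentiableAt ℝ (fun x : ℝ × ℝ => f x.1 x.2) (u, w) :=
    (hf.contDiffAt (hV.mem_nhds hx)).differentiableAt (by simp)
  have h1 := DifferentiableAt.comp (f := fun t : ℝ => (t, w)) u h0
    (hasFDerivAt_prodMk_left u w).differentiableAt
  exact h1.hasDerivAt

theorem hasDerivAt_pdw (hV : IsOpen V)
    (hf : ContDiffOn ℝ (⊤ : ℕ∞) (fun x : ℝ × ℝ => f x.1 x.2) V) (hx : (u, w) ∈ V) :
    HasDerivAt (fun t => f u t) (pdw f u w) w := by
  have h0 : DifferentiableAt ℝ (fun x : ℝ × ℝ => f x.1 x.2) (u, w) :=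
    (hf.contDiffAt (hV.mem_nhds hx)).differentiableAt (by simp)
  have h1 := h0.comp w (hasFDerivAt_prodMk_right u w).differentiableAt
  exact h1.hasDerivAt

theorem pdu_eq_fderiv (hV : IsOpen V)
    (hf : ContDiffOn ℝ (⊤ : ℕ∞) (fun x : ℝ × ℝ => f x.1 x.2) V) (hx : (u, w) ∈ V) :
    pdu f u w = fderiv ℝ (fun x : ℝ × ℝ => f x.1 x.2) (u, w) (1, 0) := by
  have h0 : DifferentiableAt ℝ (fun x : ℝ × ℝ => f x.1 x.2) (u, w) :=
    (hf.contDiffAt (hV.mem_nhds hx)).differentiableAt (by simp)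
  have h1 := HasFDerivAt.comp (f := fun t : ℝ => (t, w)) u h0.hasFDerivAt
    (hasFDerivAt_prodMk_left u w)
  simpa using (hasDerivAt_pdu hV hf hx).unique h1.hasDerivAt

theorem pdw_eq_fderiv (hV : IsOpen V)
    (hf : ContDiffOn ℝ (⊤ : ℕ∞) (fun x : ℝ × ℝ => f x.1 x.2) V) (hx : (u, w) ∈ V) :
    pdw f u w = fderiv ℝ (fun x : ℝ × ℝ => f x.1 x.2) (u, w) (0, 1) := by
  have h0 : DifferentiableAt ℝ (fun x : ℝ × ℝ => f x.1 x.2) (u, w) :=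
    (hf.contDiffAt (hV.mem_nhds hx)).differentiableAt (by simp)
  have h1 := h0.hasFDerivAt.comp w (hasFDerivAt_prodMk_right u w)
  simpa using (hasDerivAt_pdw hV hf hx).unique h1.hasDerivAt

theorem contDiffOn_pdu (hV : IsOpen V)
    (hf : ContDiffOn ℝ (⊤ : ℕ∞) (fun x : ℝ × ℝ => f x.1 x.2) V) :
    ContDiffOn ℝ (⊤ : ℕ∞) (fun x : ℝ × ℝ => pdu f x.1 x.2) V :=
  ((hf.fderiv_of_isOpen hV (m := (⊤ : ℕ∞)) le_rfl).clm_apply contDiffOn_const).congr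
    fun _ hx => pdu_eq_fderiv hV hf hx

theorem contDiffOn_pdw (hV : IsOpen V)
    (hf : ContDiffOn ℝ (⊤ : ℕ∞) (fun x : ℝ × ℝ => f x.1 x.2) V) :
    ContDiffOn ℝ (⊤ : ℕ∞) (fun x : ℝ × ℝ => pdw f x.1 x.2) V :=
  ((hf.fderiv_of_isOpen hV (m := (⊤ : ℕ∞)) le_rfl).clm_apply contDiffOn_const).congr
    fun _ hx => pdw_eq_fderiv hV hf hx

theorem pdu_eq_of_eqOn (hV : IsOpen V) (hfg : ∀ x ∈ V, f x.1 x.2 = g x.1 x.2)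
    (hx : (u, w) ∈ V) {d : ℝ} (hg : HasDerivAt (fun t => g t w) d u) : pdu f u w = d := by
  have hmem : ∀ᶠ t in nhds u, (t, w) ∈ V :=
    (Continuous.prodMk_left w).continuousAt.eventually (hV.mem_nhds hx)
  exact (hg.congr_of_eventuallyEq (hmem.mono fun t ht => hfg (t, w) ht)).deriv

theorem pdw_eq_of_eqOn (hV : IsOpen V) (hfg : ∀ x ∈ V, f x.1 x.2 = g x.1 x.2)
    (hx : (u, w) ∈ V) {d : ℝ} (hg : HasDerivAt (fun t => g u t) d w) : pdw f u w = d := by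
  have hmem : ∀ᶠ t in nhds w, (u, t) ∈ V :=
    (Continuous.prodMk_right u).continuousAt.eventually (hV.mem_nhds hx)
  exact (hg.congr_of_eventuallyEq (hmem.mono fun t ht => hfg (u, t) ht)).deriv

end SlicewiseDerivatives

/-- Iterated partial derivatives of a linear combination of smooth functions. -/
theorem pd_linear_combination (c d : ℝ) {p q : ℝ → ℝ → ℝ}
    (hp : ContDiff ℝ (⊤ : ℕ∞) (fun x : ℝ × ℝ => p x.1 x.2))
    (hq : ContDiff ℝ (⊤ : ℕ∞) (fun x : ℝ × ℝ => q x.1 x.2)) (i j : ℕ) :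
    pd i j (fun u w => c * p u w + d * q u w) =
      fun u w => c * pd i j p u w + d * pd i j q u w := by
  have hw : ∀ j, ContDiffOn ℝ (⊤ : ℕ∞) (fun x : ℝ × ℝ => pdw^[j] p x.1 x.2) univ ∧
      ContDiffOn ℝ (⊤ : ℕ∞) (fun x : ℝ × ℝ => pdw^[j] q x.1 x.2) univ ∧
      pdw^[j] (fun u w => c * p u w + d * q u w) =
        fun u w => c * pdw^[j] p u w + d * pdw^[j] q u w := by
    intro j
    induction j with
    | zero => exact ⟨hp.contDiffOn, hq.contDiffOn, rfl⟩
    | succ j ih =>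
      simp only [Function.iterate_succ_apply']
      refine ⟨contDiffOn_pdw isOpen_univ ih.1, contDiffOn_pdw isOpen_univ ih.2.1, ?_⟩
      rw [ih.2.2]
      funext u w
      exact (((hasDerivAt_pdw isOpen_univ ih.1 (mem_univ (u, w))).const_mul c).add
        ((hasDerivAt_pdw isOpen_univ ih.2.1 (mem_univ (u, w))).const_mul d)).deriv
  have hu : ContDiffOn ℝ (⊤ : ℕ∞) (fun x : ℝ × ℝ => pd i j p x.1 x.2) univ ∧
      ContDiffOn ℝ (⊤ : ℕ∞) (fun x : ℝ × ℝ => pd i j q x.1 x.2) univ ∧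
      pd i j (fun u w => c * p u w + d * q u w) =
        fun u w => c * pd i j p u w + d * pd i j q u w := by
    induction i with
    | zero => exact hw j
    | succ i ih =>
      simp only [pd, Function.iterate_succ_apply'] at ih ⊢
      refine ⟨contDiffOn_pdu isOpen_univ ih.1, contDiffOn_pdu isOpen_univ ih.2.1, ?_⟩
      rw [ih.2.2]
      funext u w
      exact (((hasDerivAt_pdu isOpen_univ ih.1 (mem_univ (u, w))).const_mul c).add
        ((hasDerivAt_pdu isOpen_univ ih.2.1 (mem_univ (u, w))).const_mul d)).deriv
  exact hu.2.2

/-- An `A₂` singularity whose Hessian is diagonal and nondegenerate along the second axis has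
vanishing second and nonvanishing third derivative along the first axis. -/
theorem pd_of_hasAkSingAt_two {H : ℝ → ℝ → ℝ} (h11 : pd 1 1 H 0 0 = 0)
    (h02 : pd 0 2 H 0 0 ≠ 0) (hA : HasAkSingAt H 2) :
    pd 2 0 H 0 0 = 0 ∧ pd 3 0 H 0 0 ≠ 0 := by
  obtain ⟨U, V, φ, ψ, ε₁, ε₂, hU, hV, h0U, h0V, hφ, hψ, hφV, hψU, hψφ, hφψ, hφ0, hε₁, hε₂,
    hform⟩ := hA
  have hε₂0 : ε₂ ≠ 0 := by rcases hε₂ with h | h <;> rw [h] <;> norm_num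
  have hψ0 : ψ (0, 0) = (0, 0) := by
    have := hψφ _ h0U
    rwa [hφ0] at this
  set X : ℝ → ℝ → ℝ := fun u w => (ψ (u, w)).1 with hXdef
  set Y : ℝ → ℝ → ℝ := fun u w => (ψ (u, w)).2 with hYdef
  have hX : ContDiffOn ℝ (⊤ : ℕ∞) (fun x : ℝ × ℝ => X x.1 x.2) V := hψ.fst
  have hY : ContDiffOn ℝ (⊤ : ℕ∞) (fun x : ℝ × ℝ => Y x.1 x.2) V := hψ.snd
  have hX0 : X 0 0 = 0 := by simp [hXdef, hψ0]
  have hY0 : Y 0 0 = 0 := by simp [hYdef, hψ0]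
  have hH : ∀ x ∈ V, H x.1 x.2 = H 0 0 + ε₁ * X x.1 x.2 ^ 2 + ε₂ * Y x.1 x.2 ^ 3 := by
    intro x hx
    have := hform (ψ x) (hψU hx)
    rwa [hφψ x hx] at this
  have hXu := contDiffOn_pdu hV hX
  have hYu := contDiffOn_pdu hV hY
  have hXw := contDiffOn_pdw hV hX
  have hYw := contDiffOn_pdw hV hY
  have hXuu := contDiffOn_pdu hV hXu
  have hYuu := contDiffOn_pdu hV hYu
  have hHw : ∀ x ∈ V, pdw H x.1 x.2 = ε₁ * (2 * X x.1 x.2 * pdw X x.1 x.2) +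
      ε₂ * (3 * Y x.1 x.2 ^ 2 * pdw Y x.1 x.2) := by
    intro x hx
    refine pdw_eq_of_eqOn (g := fun u w => H 0 0 + ε₁ * X u w ^ 2 + ε₂ * Y u w ^ 3) hV hH hx ?_
    convert! ((((hasDerivAt_pdw hV hX hx).pow 2).const_mul ε₁).const_add (H 0 0)).add
      (((hasDerivAt_pdw hV hY hx).pow 3).const_mul ε₂) using 1
    norm_num
  have hHu : ∀ x ∈ V, pdu H x.1 x.2 = ε₁ * (2 * X x.1 x.2 * pdu X x.1 x.2) +
      ε₂ * (3 * Y x.1 x.2 ^ 2 * pdu Y x.1 x.2) := by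
    intro x hx
    refine pdu_eq_of_eqOn (g := fun u w => H 0 0 + ε₁ * X u w ^ 2 + ε₂ * Y u w ^ 3) hV hH hx ?_
    convert! ((((hasDerivAt_pdu hV hX hx).pow 2).const_mul ε₁).const_add (H 0 0)).add
      (((hasDerivAt_pdu hV hY hx).pow 3).const_mul ε₂) using 1
    norm_num
  have hHww : pd 0 2 H 0 0 = 2 * ε₁ * pdw X 0 0 ^ 2 := by
    refine pdw_eq_of_eqOn (f := pdw H) (g := fun u w => ε₁ * (2 * X u w * pdw X u w) +
      ε₂ * (3 * Y u w ^ 2 * pdw Y u w)) hV hHw h0V ?_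
    convert! ((((hasDerivAt_pdw hV hX h0V).const_mul 2).mul
      (hasDerivAt_pdw hV hXw h0V)).const_mul ε₁).add
      (((((hasDerivAt_pdw hV hY h0V).pow 2).const_mul 3).mul
      (hasDerivAt_pdw hV hYw h0V)).const_mul ε₂) using 1
    simp [hX0, hY0]
    ring
  have hHuw : pd 1 1 H 0 0 = 2 * ε₁ * (pdu X 0 0 * pdw X 0 0) := by
    refine pdu_eq_of_eqOn (f := pdw H) (g := fun u w => ε₁ * (2 * X u w * pdw X u w) +
      ε₂ * (3 * Y u w ^ 2 * pdw Y u w)) hV hHw h0V ?_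
    convert! ((((hasDerivAt_pdu hV hX h0V).const_mul 2).mul
      (hasDerivAt_pdu hV hXw h0V)).const_mul ε₁).add
      (((((hasDerivAt_pdu hV hY h0V).pow 2).const_mul 3).mul
      (hasDerivAt_pdu hV hYw h0V)).const_mul ε₂) using 1
    simp [hX0, hY0]
    ring
  have hHuu : ∀ x ∈ V, pdu (pdu H) x.1 x.2 =
      ε₁ * (2 * (pdu X x.1 x.2 * pdu X x.1 x.2 + X x.1 x.2 * pdu (pdu X) x.1 x.2)) +
      ε₂ * (Y x.1 x.2 * (6 * pdu Y x.1 x.2 ^ 2 + 3 * Y x.1 x.2 * pdu (pdu Y) x.1 x.2)) := by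
    intro x hx
    refine pdu_eq_of_eqOn (g := fun u w => ε₁ * (2 * X u w * pdu X u w) +
      ε₂ * (3 * Y u w ^ 2 * pdu Y u w)) hV hHu hx ?_
    convert! ((((hasDerivAt_pdu hV hX hx).const_mul 2).mul
      (hasDerivAt_pdu hV hXu hx)).const_mul ε₁).add
      (((((hasDerivAt_pdu hV hY hx).pow 2).const_mul 3).mul
      (hasDerivAt_pdu hV hYu hx)).const_mul ε₂) using 1
    simp
    ring
  have hHuuu : pd 3 0 H 0 0 = 6 * ε₁ * pdu X 0 0 * pdu (pdu X) 0 0 + 6 * ε₂ * pdu Y 0 0 ^ 3 := by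
    refine pdu_eq_of_eqOn (f := pdu (pdu H))
      (g := fun u w => ε₁ * (2 * (pdu X u w * pdu X u w + X u w * pdu (pdu X) u w)) +
      ε₂ * (Y u w * (6 * pdu Y u w ^ 2 + 3 * Y u w * pdu (pdu Y) u w))) hV hHuu h0V ?_
    have dX := hasDerivAt_pdu hV hX h0V
    have dY := hasDerivAt_pdu hV hY h0V
    have dXu := hasDerivAt_pdu hV hXu h0V
    have dYu := hasDerivAt_pdu hV hYu h0V
    have dXuu := hasDerivAt_pdu hV hXuu h0V
    have dYuu := hasDerivAt_pdu hV hYuu h0V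
    convert! ((((dXu.mul dXu).add (dX.mul dXuu)).const_mul 2).const_mul ε₁).add
      ((dY.mul (((dYu.pow 2).const_mul 6).add ((dY.const_mul 3).mul dYuu))).const_mul ε₂) using 1
    simp [hX0, hY0]
    ring
  have hXw0 : pdw X 0 0 ≠ 0 := fun h => h02 (by rw [hHww, h]; ring)
  have hε₁0 : ε₁ ≠ 0 := by rcases hε₁ with h | h <;> rw [h] <;> norm_num
  have hXu0 : pdu X 0 0 = 0 := by
    rw [hHuw] at h11
    simpa [hε₁0, hXw0] using h11
  have hYu0 : pdu Y 0 0 ≠ 0 := by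
    intro h
    have dφ : HasFDerivAt φ (fderiv ℝ φ (0, 0)) (ψ (0, 0)) := by
      rw [hψ0]
      exact ((hφ.contDiffAt (hU.mem_nhds h0U)).differentiableAt (by simp)).hasFDerivAt
    have dψ : HasDerivAt (fun t : ℝ => ψ (t, 0)) ((0, 0) : ℝ × ℝ) 0 := by
      have := (hasDerivAt_pdu hV hX h0V).prodMk (hasDerivAt_pdu hV hY h0V)
      rwa [hXu0, h] at this
    have hcomp : HasDerivAt (fun t : ℝ => φ (ψ (t, 0))) (fderiv ℝ φ (0, 0) (0, 0)) 0 :=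
      dφ.comp_hasDerivAt 0 dψ
    have hmem : ∀ᶠ t : ℝ in nhds 0, (t, (0 : ℝ)) ∈ V :=
      (Continuous.prodMk_left (0 : ℝ)).continuousAt.eventually (hV.mem_nhds h0V)
    have hid : HasDerivAt (fun t : ℝ => φ (ψ (t, 0))) ((1, 0) : ℝ × ℝ) 0 :=
      ((hasDerivAt_id (0 : ℝ)).prodMk (hasDerivAt_const 0 (0 : ℝ))).congr_of_eventuallyEq
        (hmem.mono fun t ht => hφψ _ ht)
    have := congrArg Prod.fst (hcomp.unique hid)
    rw [Prod.mk_zero_zero, map_zero] at this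
    simp at this
  refine ⟨(hHuu _ h0V).trans ?_, ?_⟩
  · simp [hX0, hY0, hXu0]
  · rw [hHuuu, hXu0]
    simp [hε₂0, hYu0]

/-- for `ν₀ = ±(0, −a_{n+1,1} cos θ₀/A(θ₀), (n+1)! sin θ₀/A(θ₀))`, the height
function `h_{ν₀}` has an `A₂` singularity at the origin iff `(0,θ₀)` is a parabolic point but
not a ridge point over the singularity. -/
theorem height_A2_over_singularity_iff (p q : ℝ → ℝ → ℝ) (b : ℕ → ℝ) (a : ℕ → ℕ → ℝ)
    (n : ℕ) (hn : 1 ≤ n) (hNF : NormalFormN (max 4 (n + 2)) p q b a)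
    (hvan : ∀ i, 2 ≤ i → i ≤ n → a i 1 = 0) (hnz : a (n + 1) 1 ≠ 0)
    (θ₀ : ℝ) (hθ : θ₀ ∈ Set.Ioo (-(π / 2)) (π / 2)) (σ : ℝ) (hσ : σ = 1 ∨ σ = -1) :
    HasAkSingAt
      (hgt p q
        (0,
          σ * (-(a (n + 1) 1) * Real.cos θ₀ /
            Real.sqrt (a (n + 1) 1 ^ 2 * Real.cos θ₀ ^ 2 +
              (Nat.factorial (n + 1) : ℝ) ^ 2 * Real.sin θ₀ ^ 2)),
          σ * ((Nat.factorial (n + 1) : ℝ) * Real.sin θ₀ /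
            Real.sqrt (a (n + 1) 1 ^ 2 * Real.cos θ₀ ^ 2 +
              (Nat.factorial (n + 1) : ℝ) ^ 2 * Real.sin θ₀ ^ 2)))) 2 ↔
      (a (n + 1) 1 * b 2 * Real.cos θ₀ - (Nat.factorial (n + 1) : ℝ) * a 2 0 * Real.sin θ₀ = 0 ∧
        a (n + 1) 1 * b 3 * Real.cos θ₀ -
          (Nat.factorial (n + 1) : ℝ) * a 3 0 * Real.sin θ₀ ≠ 0) := by
  obtain ⟨hp, hq, -, -, hp10, hp01, hq10, hq01, hp02, hpb, hpz, hqa, ha11, ha02⟩ := hNF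
  have hN : 4 ≤ max 4 (n + 2) := le_max_left _ _
  have hcos : 0 < Real.cos θ₀ := Real.cos_pos_of_mem_Ioo hθ
  set N : ℝ := (Nat.factorial (n + 1) : ℝ)
  set r : ℝ := Real.sqrt (a (n + 1) 1 ^ 2 * Real.cos θ₀ ^ 2 + N ^ 2 * Real.sin θ₀ ^ 2) with hr
  have hr0 : r ≠ 0 := by
    refine (Real.sqrt_pos.2 ?_).ne'
    have : 0 < a (n + 1) 1 ^ 2 * Real.cos θ₀ ^ 2 := by positivity
    nlinarith [mul_nonneg (sq_nonneg N) (sq_nonneg (Real.sin θ₀))]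
  have hσ0 : σ ≠ 0 := by rcases hσ with h | h <;> rw [h] <;> norm_num
  set c : ℝ := σ * (-(a (n + 1) 1) * Real.cos θ₀ / r) with hc
  set d : ℝ := σ * (N * Real.sin θ₀ / r) with hd
  have hhgt : hgt p q (0, c, d) = fun u w => c * p u w + d * q u w := by
    funext u w
    simp only [hgt, dot3, gmap]
    ring
  have hsmooth : ContDiff ℝ (⊤ : ℕ∞) (fun x : ℝ × ℝ => c * p x.1 x.2 + d * q x.1 x.2) :=
    (contDiff_const.mul hp).add (contDiff_const.mul hq)
  have hpd : ∀ i j, pd i j (hgt p q (0, c, d)) 0 0 = c * pd i j p 0 0 + d * pd i j q 0 0 := by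
    intro i j
    rw [hhgt, pd_linear_combination c d hp hq]
  have hc0 : c ≠ 0 :=
    mul_ne_zero hσ0 (div_ne_zero (mul_ne_zero (neg_ne_zero.2 hnz) hcos.ne') hr0)
  have h10 : pd 1 0 (hgt p q (0, c, d)) 0 0 = 0 := by rw [hpd, hp10, hq10]; ring
  have h01 : pd 0 1 (hgt p q (0, c, d)) 0 0 = 0 := by rw [hpd, hp01, hq01]; ring
  have h11 : pd 1 1 (hgt p q (0, c, d)) 0 0 = 0 := by
    rw [hpd, hpz 1 1 (by omega) (by omega) (by omega) (by omega),
      hqa 1 1 (by omega) (by omega), ha11]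
    ring
  have h02 : pd 0 2 (hgt p q (0, c, d)) 0 0 ≠ 0 := by
    rw [hpd, hp02, hqa 0 2 (by omega) (by omega), ha02]
    simpa using hc0
  have hi : ∀ i, 2 ≤ i → i ≤ 4 → pd i 0 (hgt p q (0, c, d)) 0 0 =
      -(σ / r) * (a (n + 1) 1 * b i * Real.cos θ₀ - N * a i 0 * Real.sin θ₀) := by
    intro i h2 h4
    rw [hpd, hpb i h2 (by omega), hqa i 0 (by omega) (by omega), hc, hd]
    field_simp
    ring
  have hk : -(σ / r) ≠ 0 := neg_ne_zero.2 (div_ne_zero hσ0 hr0)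
  have h2 := hi 2 le_rfl (by norm_num)
  have h3 := hi 3 (by norm_num) (by norm_num)
  constructor
  · intro hA
    obtain ⟨e20, e30⟩ := pd_of_hasAkSingAt_two h11 h02 hA
    rw [h2] at e20
    rw [h3] at e30
    exact ⟨(mul_eq_zero.1 e20).resolve_left hk, right_ne_zero_of_mul e30⟩
  · rintro ⟨e20, e30⟩
    refine hasAkSingAt_two_of_pd (by rw [hhgt]; exact hsmooth) h10 h01 h11 h02 ?_ ?_
    · rw [h2, e20, mul_zero]
    · rw [h3]
      exact mul_ne_zero hk e30
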